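/- arXiv:1004.2338 — 7 statements merged into one kernel-verified Lean document; each statement's English description precedes it below -/
import Mathlib

section
/- Let n = 2k with k ≥ 1, and let a_1, …, a_n be nonnegative real numbers; write m_i for the i-th smallest and M_i for the i-th largest of these values (so m_1 ≤ m_2 ≤ … ≤ m_k ≤ M_k ≤ … ≤ M_1). Then the minimum of SOP(π) = Σ_{i=1}^n a_{π_i}·a_{π_{i⊕1}} over all circular permutations π of {1,…,n} equals m_1·M_1 + m_k·M_k + Σ_{i=1}^{k−1} (M_i·m_{i+1} + m_i·M_{i+1}); in particular this value is attained by the circular arrangement whose cyclically adjacent pairs are exactly {M_1,m_1}, {m_k,M_k}, and {M_i,m_{i+1}}, {m_i,M_{i+1}} for i = 1,…,k−1. -/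
/-- The cyclic successor `i ⊕ 1` in `Fin n`. -/
def cycSucc {n : ℕ} (i : Fin n) : Fin n :=
  ⟨(i.val + 1) % n, Nat.mod_lt _ (Nat.lt_of_le_of_lt (Nat.zero_le i.val) i.isLt)⟩

/-- The sum of adjacent products of a circular arrangement `π` of the values `a`. -/
noncomputable def SOP {n : ℕ} (a : Fin n → ℝ) (π : Equiv.Perm (Fin n)) : ℝ :=
  ∑ i : Fin n, a (π i) * a (π (cycSucc i))

theorem cycSucc_injective {n : ℕ} : Function.Injective (cycSucc : Fin n → Fin n) := by
  intro i j h
  have h' : (i.val + 1) ≡ (j.val + 1) [MOD n] := congrArg Fin.val h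
  exact Fin.ext (Nat.ModEq.eq_of_lt_of_lt (Nat.ModEq.add_right_cancel' 1 h') i.isLt j.isLt)

/-- A nonempty set of positions closed under the cyclic successor contains every position. -/
theorem mem_of_cycSucc_mem {n : ℕ} (s : Set (Fin n)) (hs : ∀ i ∈ s, cycSucc i ∈ s)
    {i₀ : Fin n} (h₀ : i₀ ∈ s) (i : Fin n) : i ∈ s := by
  have hn : 0 < n := i.pos
  have key : ∀ j : ℕ, (⟨(i₀.val + j) % n, Nat.mod_lt _ hn⟩ : Fin n) ∈ s := by
    intro j
    induction j with
    | zero => simpa [Nat.mod_eq_of_lt i₀.isLt] using h₀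
    | succ j ih =>
      have h := hs _ ih
      simpa only [cycSucc, Nat.mod_add_mod, add_assoc] using h
  have h := key (i.val + n - i₀.val)
  have e : i₀.val + (i.val + n - i₀.val) = i.val + n := by omega
  simpa only [e, Nat.add_mod_right, Nat.mod_eq_of_lt i.isLt] using h

/-- The number of indices at which both permutations take small values. -/
def lowCount {n : ℕ} (f g : Equiv.Perm (Fin n)) (u v : ℕ) : ℕ :=
  (Finset.univ.filter fun i => (f i).val ≤ u ∧ (g i).val ≤ v).card

theorem card_filter_perm_le {n : ℕ} (f : Equiv.Perm (Fin n)) {u : ℕ} (hu : u < n) :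
    (Finset.univ.filter fun i => (f i).val ≤ u).card = u + 1 := by
  rw [← Fin.card_Iic (⟨u, hu⟩ : Fin n)]
  refine Finset.card_bij (fun i _ => f i) ?_ (fun i _ j _ h => f.injective h) ?_
  · intro i hi
    simpa [Fin.le_def] using hi
  · intro y hy
    exact ⟨f.symm y, by simpa [Fin.le_def] using hy, by simp⟩

theorem le_lowCount {n : ℕ} (f g : Equiv.Perm (Fin n)) {u v : ℕ} (hu : u < n) (hv : v < n) :
    u + v + 2 - n ≤ lowCount f g u v := by
  have h := Finset.card_union_add_card_inter
    (Finset.univ.filter fun i => (f i).val ≤ u) (Finset.univ.filter fun i => (g i).val ≤ v)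
  rw [card_filter_perm_le f hu, card_filter_perm_le g hv, ← Finset.filter_and] at h
  have h' := Finset.card_le_univ ((Finset.univ.filter fun i => (f i).val ≤ u) ∪
    (Finset.univ.filter fun i => (g i).val ≤ v))
  rw [Fintype.card_fin] at h'
  unfold lowCount
  omega

theorem lowCount_revPerm {n : ℕ} {u v : ℕ} (hu : u < n) (hv : v < n) :
    lowCount (1 : Equiv.Perm (Fin n)) Fin.revPerm u v = u + v + 2 - n := by
  have h : lowCount (1 : Equiv.Perm (Fin n)) Fin.revPerm u v
      = (Finset.Icc (n - 1 - v) u).card := by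
    refine Finset.card_bij (fun i _ => i.val) ?_ (fun i _ j _ h => Fin.ext h) ?_
    · intro i hi
      simp [Fin.val_rev] at hi ⊢
      omega
    · intro y hy
      rw [Finset.mem_Icc] at hy
      refine ⟨⟨y, by omega⟩, ?_, rfl⟩
      simp [Fin.val_rev]
      omega
  rw [h, Nat.card_Icc]
  omega

/-- On a single cycle, the lowest `u + 1` and the highest `u + 1` values cannot be matched
only with each other unless they exhaust the cycle. -/
theorem one_le_lowCount_add_lowCount {n : ℕ} (f g : Equiv.Perm (Fin n))
    (hg : ∀ i, g i = f (cycSucc i)) {u v : ℕ} (huv : u < v) (hn : u + v + 2 = n) :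
    1 ≤ lowCount f g u v + lowCount f g v u := by
  by_contra! hlt
  have h1 : lowCount f g u v = 0 := by omega
  have h2 : lowCount f g v u = 0 := by omega
  simp only [lowCount, Finset.card_eq_zero, Finset.filter_eq_empty_iff, Finset.mem_univ,
    true_implies, not_and, not_le] at h1 h2
  have hcompl : (Finset.univ.filter fun i => ¬ (g i).val ≤ u).card = v + 1 := by
    have h := Finset.card_filter_add_card_filter_not (s := Finset.univ)
      (fun i : Fin n => (g i).val ≤ u)
    rw [card_filter_perm_le g (by omega), Finset.card_univ, Fintype.card_fin] at h
    omega
  have heq : (Finset.univ.filter fun i => (f i).val ≤ v)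
      = Finset.univ.filter fun i => ¬ (g i).val ≤ u := by
    refine Finset.eq_of_subset_of_card_le ?_ ?_
    · intro i hi
      simp only [Finset.mem_filter, Finset.mem_univ, true_and] at hi ⊢
      exact not_le.2 (h2 hi)
    · rw [hcompl, card_filter_perm_le f (by omega)]
  have h3 : ∀ i, v < (f i).val → (g i).val ≤ u := by
    intro i hi
    by_contra hgi
    have : i ∈ Finset.univ.filter fun i => (f i).val ≤ v := by
      rw [heq]
      simpa using hgi
    simp only [Finset.mem_filter, Finset.mem_univ, true_and] at this
    omega
  have hall := mem_of_cycSucc_mem {i : Fin n | (f i).val ≤ u ∨ v < (f i).val}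
    (fun i hi => by
      simp only [Set.mem_ofPred_eq, ← hg] at hi ⊢
      rcases hi with hi | hi
      · exact Or.inr (h1 hi)
      · exact Or.inl (h3 i hi))
    (i₀ := f.symm ⟨0, by omega⟩) (by simp) (f.symm ⟨v, by omega⟩)
  simp only [Set.mem_ofPred_eq, Equiv.apply_symm_apply] at hall
  omega

/-- Summation by parts for a sum of products along two permutations. -/
theorem sum_perm_mul_perm_eq {m : ℕ} (b : ℕ → ℝ) (f g : Equiv.Perm (Fin (m + 1))) :
    ∑ i, b (f i) * b (g i)
      = ∑ i : Fin (m + 1), (b m ^ 2 - 2 * b m * (b m - b i))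
        + ∑ u ∈ Finset.range m, ∑ v ∈ Finset.range m,
            (b (u + 1) - b u) * (b (v + 1) - b v) * (lowCount f g u v : ℝ) := by
  have hdiff : ∀ x : Fin (m + 1), b m - b x
      = ∑ u ∈ Finset.range m, (b (u + 1) - b u) * (if x.val ≤ u then 1 else 0) := by
    intro x
    rw [← Finset.sum_Ico_sub b (Nat.lt_succ_iff.1 x.isLt)]
    simp only [mul_ite, mul_one, mul_zero]
    rw [← Finset.sum_filter]
    refine Finset.sum_congr ?_ fun _ _ => rfl
    ext u
    simp only [Finset.mem_Ico, Finset.mem_filter, Finset.mem_range]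
    tauto
  have hcross : ∑ i, (b m - b (f i)) * (b m - b (g i))
      = ∑ u ∈ Finset.range m, ∑ v ∈ Finset.range m,
            (b (u + 1) - b u) * (b (v + 1) - b v) * (lowCount f g u v : ℝ) := by
    simp only [hdiff, Finset.sum_mul_sum]
    rw [Finset.sum_comm]
    refine Finset.sum_congr rfl fun u _ => ?_
    rw [Finset.sum_comm]
    refine Finset.sum_congr rfl fun v _ => ?_
    rw [lowCount, Finset.card_filter, Nat.cast_sum, Finset.mul_sum]
    refine Finset.sum_congr rfl fun i _ => ?_
    by_cases h1 : (f i).val ≤ u <;> by_cases h2 : (g i).val ≤ v <;> simp [h1, h2]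
  have hf := Equiv.sum_comp f fun x => b m - b x
  have hg := Equiv.sum_comp g fun x => b m - b x
  rw [← hcross, Finset.sum_sub_distrib, ← Finset.mul_sum]
  have hexp : ∑ i, b (f i) * b (g i)
      = ∑ i : Fin (m + 1), (b m ^ 2 - b m * (b m - b (f i)) - b m * (b m - b (g i))
          + (b m - b (f i)) * (b m - b (g i))) :=
    Finset.sum_congr rfl fun i _ => by ring
  rw [hexp, Finset.sum_add_distrib, Finset.sum_sub_distrib, Finset.sum_sub_distrib,
    ← Finset.mul_sum, ← Finset.mul_sum, hf, hg]
  ring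

theorem sum_range_two_mul_add_one (m : ℕ) (f : ℕ → ℝ) :
    ∑ u ∈ Finset.range (2 * m + 1), f u
      = ∑ u ∈ Finset.range m, (f u + f (2 * m - u)) + f m := by
  have h : 2 * m + 1 = (m + 1) + m := by ring
  rw [h, Finset.sum_range_add, Finset.sum_range_succ, Finset.sum_add_distrib,
    ← Finset.sum_range_reflect (fun u => f (m + 1 + u))]
  have : ∀ u ∈ Finset.range m, f (m + 1 + (m - 1 - u)) = f (2 * m - u) := by
    intro u hu
    rw [Finset.mem_range] at hu
    congr 1
    omega
  rw [Finset.sum_congr rfl this]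
  ring

/-- The claimed minimum exceeds the fully reversed pairing by products of increments. -/
theorem min_eq_sum_rev_add (m : ℕ) (b : ℕ → ℝ) :
    b 0 * b (2 * m + 1) + b m * b (m + 1)
        + ∑ j ∈ Finset.range m, (b (2 * m + 1 - j) * b (j + 1) + b j * b (2 * m - j))
      = ∑ i : Fin (2 * m + 1 + 1), b ((1 : Equiv.Perm (Fin (2 * m + 1 + 1))) i) * b (Fin.revPerm i)
        + ∑ j ∈ Finset.range m, (b (j + 1) - b j) * (b (2 * m - j + 1) - b (2 * m - j)) := by
  have hrev : ∑ i : Fin (2 * m + 1 + 1), b ((1 : Equiv.Perm (Fin (2 * m + 1 + 1))) i) * b (Fin.revPerm i)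
      = ∑ i ∈ Finset.range (2 * m + 1 + 1), b i * b (2 * m + 1 - i) := by
    rw [← Fin.sum_univ_eq_sum_range (fun i => b i * b (2 * m + 1 - i))]
    refine Finset.sum_congr rfl fun i _ => ?_
    simp [Fin.val_rev]
  rw [hrev, Finset.sum_range_succ', sum_range_two_mul_add_one]
  have hm : 2 * m + 1 - (m + 1) = m := by omega
  rw [hm, Nat.sub_zero]
  have hsum : ∑ j ∈ Finset.range m, (b (2 * m + 1 - j) * b (j + 1) + b j * b (2 * m - j))
      = ∑ j ∈ Finset.range m, (b (j + 1) * b (2 * m + 1 - (j + 1))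
          + b (2 * m - j + 1) * b (2 * m + 1 - (2 * m - j + 1)))
        + ∑ j ∈ Finset.range m, (b (j + 1) - b j) * (b (2 * m - j + 1) - b (2 * m - j)) := by
    rw [← Finset.sum_add_distrib]
    refine Finset.sum_congr rfl fun j hj => ?_
    rw [Finset.mem_range] at hj
    have e1 : 2 * m + 1 - (j + 1) = 2 * m - j := by omega
    have e2 : 2 * m + 1 - (2 * m - j + 1) = j := by omega
    have e3 : 2 * m + 1 - j = 2 * m - j + 1 := by omega
    rw [e1, e2, e3]
    ring
  rw [hsum]
  ring

theorem min_le_sum_cycle {m : ℕ} (b : ℕ → ℝ)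
    (hb : ∀ i j : ℕ, i ≤ j → j < 2 * m + 2 → b i ≤ b j)
    (f g : Equiv.Perm (Fin (2 * m + 1 + 1))) (hg : ∀ i, g i = f (cycSucc i)) :
    b 0 * b (2 * m + 1) + b m * b (m + 1)
        + ∑ j ∈ Finset.range m, (b (2 * m + 1 - j) * b (j + 1) + b j * b (2 * m - j))
      ≤ ∑ i, b (f i) * b (g i) := by
  rw [min_eq_sum_rev_add, sum_perm_mul_perm_eq, sum_perm_mul_perm_eq b f g, add_assoc]
  refine add_le_add_right ?_ _
  rw [← le_sub_iff_add_le', ← Finset.sum_sub_distrib]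
  simp only [← Finset.sum_sub_distrib, ← mul_sub]
  have hd : ∀ u ∈ Finset.range (2 * m + 1), 0 ≤ b (u + 1) - b u := by
    intro u hu
    rw [Finset.mem_range] at hu
    exact sub_nonneg.2 (hb _ _ (Nat.le_succ u) (by omega))
  set E : ℕ → ℕ → ℝ := fun u v => (lowCount f g u v : ℝ)
    - (lowCount (1 : Equiv.Perm (Fin (2 * m + 1 + 1))) Fin.revPerm u v : ℝ) with hE
  have hE0 : ∀ u ∈ Finset.range (2 * m + 1), ∀ v ∈ Finset.range (2 * m + 1), 0 ≤ E u v := by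
    intro u hu v hv
    rw [Finset.mem_range] at hu hv
    rw [hE, sub_nonneg, Nat.cast_le, lowCount_revPerm (by omega) (by omega)]
    exact le_lowCount f g (by omega) (by omega)
  have hE1 : ∀ j ∈ Finset.range m, 1 ≤ E j (2 * m - j) + E (2 * m - j) j := by
    intro j hj
    rw [Finset.mem_range] at hj
    have h := one_le_lowCount_add_lowCount f g hg (u := j) (v := 2 * m - j)
      (by omega) (by omega)
    have e1 : j + (2 * m - j) + 2 - (2 * m + 1 + 1) = 0 := by omega
    have e2 : 2 * m - j + j + 2 - (2 * m + 1 + 1) = 0 := by omega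
    simp only [hE]
    rw [lowCount_revPerm (by omega) (by omega), lowCount_revPerm (by omega) (by omega), e1, e2]
    simp only [Nat.cast_zero, sub_zero]
    exact_mod_cast h
  have hmem : ∀ u ∈ Finset.range (2 * m + 1), 2 * m - u ∈ Finset.range (2 * m + 1) := by
    intro u _
    rw [Finset.mem_range]
    omega
  have hterm : ∀ u ∈ Finset.range (2 * m + 1), ∀ v ∈ Finset.range (2 * m + 1),
      0 ≤ (b (u + 1) - b u) * (b (v + 1) - b v) * E u v :=
    fun u hu v hv => mul_nonneg (mul_nonneg (hd u hu) (hd v hv)) (hE0 u hu v hv)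
  calc ∑ j ∈ Finset.range m, (b (j + 1) - b j) * (b (2 * m - j + 1) - b (2 * m - j))
      ≤ ∑ u ∈ Finset.range (2 * m + 1),
          (b (u + 1) - b u) * (b (2 * m - u + 1) - b (2 * m - u)) * E u (2 * m - u) := by
        rw [sum_range_two_mul_add_one]
        refine le_add_of_le_of_nonneg (Finset.sum_le_sum fun j hj => ?_) ?_
        · have hj' := Finset.mem_range.1 hj
          have hj2 : j ∈ Finset.range (2 * m + 1) := Finset.mem_range.2 (by omega)
          have e : 2 * m - (2 * m - j) = j := by omega
          rw [e]
          nlinarith [mul_le_mul_of_nonneg_left (hE1 j hj)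
            (mul_nonneg (hd j hj2) (hd _ (hmem j hj2)))]
        · have hm : m ∈ Finset.range (2 * m + 1) := Finset.mem_range.2 (by omega)
          exact hterm m hm _ (hmem m hm)
    _ ≤ _ := Finset.sum_le_sum fun u hu =>
        Finset.single_le_sum (f := fun v => (b (u + 1) - b u) * (b (v + 1) - b v) * E u v)
          (hterm u hu) (hmem u hu)

/-- The rank placed at position `p` of the optimal circular arrangement of `2k` values. -/
def optRank (k p : ℕ) : ℕ :=
  if p % 2 = 1 ↔ p ≤ k then 2 * k - p else p - 1

theorem optRank_eq_sub {k p q : ℕ} (h : p % 2 = 1 ↔ p ≤ k) (hq : 2 * k - p = q) :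
    optRank k p = q :=
  (if_pos h).trans hq

theorem optRank_eq_pred {k p q : ℕ} (h : ¬ (p % 2 = 1 ↔ p ≤ k)) (hq : p - 1 = q) :
    optRank k p = q :=
  (if_neg h).trans hq

theorem optRank_lt {k p : ℕ} (hp : p < 2 * k) : optRank k p < 2 * k := by
  unfold optRank
  split_ifs <;> omega

theorem optRank_inj {k p q : ℕ} (hp : p < 2 * k) (hq : q < 2 * k)
    (h : optRank k p = optRank k q) : p = q := by
  unfold optRank at h
  split_ifs at h <;> omega

/-- The optimal circular arrangement of `2k` ranks. -/
noncomputable def optPerm (k : ℕ) : Equiv.Perm (Fin (2 * k)) :=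
  Equiv.ofBijective (fun p => ⟨optRank k p, optRank_lt p.isLt⟩)
    (Finite.injective_iff_bijective.1 fun p q h =>
      Fin.ext (optRank_inj p.isLt q.isLt (congrArg Fin.val h)))

theorem sum_optPerm (m : ℕ) (b : ℕ → ℝ) :
    ∑ i, b (optPerm (m + 1) i) * b (optPerm (m + 1) (cycSucc i))
      = b 0 * b (2 * m + 1) + b m * b (m + 1)
        + ∑ j ∈ Finset.range m, (b (2 * m + 1 - j) * b (j + 1) + b j * b (2 * m - j)) := by
  have h : ∑ i, b (optPerm (m + 1) i) * b (optPerm (m + 1) (cycSucc i))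
      = ∑ p ∈ Finset.range (2 * (m + 1)),
          b (optRank (m + 1) p) * b (optRank (m + 1) ((p + 1) % (2 * (m + 1)))) := by
    rw [← Fin.sum_univ_eq_sum_range (fun p =>
      b (optRank (m + 1) p) * b (optRank (m + 1) ((p + 1) % (2 * (m + 1)))))]
    rfl
  have hlen : 2 * (m + 1) = 2 * m + 1 + 1 := by ring
  rw [h, hlen, Finset.sum_range_succ', sum_range_two_mul_add_one]
  have hzero : b (optRank (m + 1) 0) * b (optRank (m + 1) ((0 + 1) % (2 * m + 1 + 1)))
      = b 0 * b (2 * m + 1) := by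
    have e1 : (0 + 1) % (2 * m + 1 + 1) = 1 := Nat.mod_eq_of_lt (by omega)
    have e2 : optRank (m + 1) 0 = 0 := optRank_eq_pred (by omega) (by omega)
    have e3 : optRank (m + 1) 1 = 2 * m + 1 :=
      optRank_eq_sub (by omega) (by omega)
    rw [e1, e2, e3]
  have hmid : b (optRank (m + 1) (m + 1))
        * b (optRank (m + 1) ((m + 1 + 1) % (2 * m + 1 + 1))) = b m * b (m + 1) := by
    rcases Nat.eq_zero_or_pos m with rfl | hm
    · simp [optRank, mul_comm]
    rw [Nat.mod_eq_of_lt (by omega : m + 1 + 1 < 2 * m + 1 + 1)]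
    rcases Nat.mod_two_eq_zero_or_one m with hpar | hpar
    · have e1 : optRank (m + 1) (m + 1) = m + 1 := optRank_eq_sub (by omega) (by omega)
      have e2 : optRank (m + 1) (m + 1 + 1) = m := optRank_eq_sub (by omega) (by omega)
      rw [e1, e2, mul_comm]
    · have e1 : optRank (m + 1) (m + 1) = m := optRank_eq_pred (by omega) (by omega)
      have e2 : optRank (m + 1) (m + 1 + 1) = m + 1 := optRank_eq_pred (by omega) (by omega)
      rw [e1, e2]
  rw [hzero, hmid]
  have hsum : ∀ j ∈ Finset.range m,
      b (optRank (m + 1) (j + 1)) * b (optRank (m + 1) ((j + 1 + 1) % (2 * m + 1 + 1)))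
        + b (optRank (m + 1) (2 * m - j + 1))
          * b (optRank (m + 1) ((2 * m - j + 1 + 1) % (2 * m + 1 + 1)))
      = b (2 * m + 1 - j) * b (j + 1) + b j * b (2 * m - j) := by
    intro j hj
    rw [Finset.mem_range] at hj
    rw [Nat.mod_eq_of_lt (by omega : j + 1 + 1 < 2 * m + 1 + 1)]
    have hlast : optRank (m + 1) ((2 * m - j + 1 + 1) % (2 * m + 1 + 1))
        = if j % 2 = 1 then 2 * m + 1 - j else j := by
      rcases Nat.eq_zero_or_pos j with rfl | hj0
      · simp [optRank]
      · rw [Nat.mod_eq_of_lt (by omega)]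
        split_ifs with hpar
        · exact optRank_eq_pred (by omega) (by omega)
        · exact optRank_eq_sub (by omega) (by omega)
    rw [hlast]
    rcases Nat.mod_two_eq_zero_or_one j with hpar | hpar
    · have e1 : optRank (m + 1) (j + 1) = 2 * m + 1 - j := optRank_eq_sub (by omega) (by omega)
      have e2 : optRank (m + 1) (j + 1 + 1) = j + 1 := optRank_eq_pred (by omega) (by omega)
      have e3 : optRank (m + 1) (2 * m - j + 1) = 2 * m - j := optRank_eq_pred (by omega) (by omega)
      rw [e1, e2, e3, if_neg (by omega)]
      ring
    · have e1 : optRank (m + 1) (j + 1) = j := optRank_eq_pred (by omega) (by omega)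
      have e2 : optRank (m + 1) (j + 1 + 1) = 2 * m - j := optRank_eq_sub (by omega) (by omega)
      have e3 : optRank (m + 1) (2 * m - j + 1) = j + 1 := optRank_eq_sub (by omega) (by omega)
      rw [e1, e2, e3, if_pos hpar]
      ring
  rw [Finset.sum_congr rfl hsum]
  ring

/-- For `n = 2k` nonnegative reals, with `b` a nondecreasing enumeration of the values
(`m_i = b (i-1)` is the `i`-th smallest, `M_i = b (2k - i)` the `i`-th largest), the
minimum of the sum of adjacent products over all circular permutations equals
`m₁M₁ + m_k M_k + ∑_{i=1}^{k-1} (M_i m_{i+1} + m_i M_{i+1})`, and it is attained. -/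
theorem DE1_even (k : ℕ) (hk : 1 ≤ k) (a : Fin (2 * k) → ℝ) (ha : ∀ i, 0 ≤ a i)
    (b : ℕ → ℝ)
    (hb_sorted : ∀ i j : ℕ, i ≤ j → j < 2 * k → b i ≤ b j)
    (hb_perm : ∃ e : Equiv.Perm (Fin (2 * k)), ∀ i, a i = b (e i)) :
    IsLeast {s : ℝ | ∃ π : Equiv.Perm (Fin (2 * k)), s = SOP a π}
      (b 0 * b (2 * k - 1) + b (k - 1) * b k
        + ∑ j ∈ Finset.range (k - 1),
            (b (2 * k - 1 - j) * b (j + 1) + b j * b (2 * k - 2 - j))) := by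
  obtain ⟨m, rfl⟩ : ∃ m, k = m + 1 := ⟨k - 1, by omega⟩
  obtain ⟨e, he⟩ := hb_perm
  have e1 : 2 * (m + 1) - 1 = 2 * m + 1 := by omega
  have e2 : 2 * (m + 1) - 2 = 2 * m := by omega
  rw [e1, e2, Nat.add_sub_cancel]
  constructor
  · refine ⟨(optPerm (m + 1)).trans e.symm, ?_⟩
    simp only [SOP, he, Equiv.trans_apply, Equiv.apply_symm_apply]
    exact (sum_optPerm m b).symm
  · rintro s ⟨π, rfl⟩
    simp only [SOP, he]
    let σ : Equiv.Perm (Fin (2 * (m + 1))) :=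
      Equiv.ofBijective cycSucc (Finite.injective_iff_bijective.1 cycSucc_injective)
    exact min_le_sum_cycle b hb_sorted (π.trans e) ((σ.trans π).trans e) fun _ => rfl
end

section
/- Let a_1, …, a_n (n ≥ 3) be nonnegative real numbers. Then there exists a circular permutation π of {1,…,n} minimizing SOP(π) = Σ_{i=1}^n a_{π_i}·a_{π_{i⊕1}} over all circular permutations, in which a minimum value among a_1,…,a_n is cyclically adjacent to a maximum value among a_1,…,a_n. -/
theorem cycSucc_eq_add_one {n : ℕ} [NeZero n] (i : Fin n) : cycSucc i = i + 1 := by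
  ext
  simp [cycSucc, Fin.val_add]

theorem val_cycSucc_of_lt {n : ℕ} {i : Fin n} (h : i.val + 1 < n) :
    (cycSucc i).val = i.val + 1 :=
  Nat.mod_eq_of_lt h

/-- `SOP` is invariant under rotation of the arrangement. -/
theorem SOP_rotate {n : ℕ} [NeZero n] (a : Fin n → ℝ) (π : Equiv.Perm (Fin n)) (p : Fin n) :
    SOP a ((Equiv.addRight p).trans π) = SOP a π := by
  unfold SOP
  rw [← Equiv.sum_comp (Equiv.addRight p) (fun i => a (π i) * a (π (cycSucc i)))]
  simp [cycSucc_eq_add_one, add_right_comm]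

/-- Reversal of the block of positions from `l` to `k`. -/
def reverseBlock {n : ℕ} (l : ℕ) (k : Fin n) : Equiv.Perm (Fin n) :=
  Function.Involutive.toPerm
    (fun i => if h : l ≤ i.val ∧ i.val ≤ k.val then ⟨k.val + l - i.val, by omega⟩ else i) (by
      intro i
      ext
      dsimp only
      split_ifs <;> dsimp only at * <;> omega)

theorem val_reverseBlock {n : ℕ} (l : ℕ) (k i : Fin n) :
    (reverseBlock l k i).val =
      if l ≤ i.val ∧ i.val ≤ k.val then k.val + l - i.val else i.val := by
  change (if h : l ≤ i.val ∧ i.val ≤ k.val then (⟨k.val + l - i.val, by omega⟩ : Fin n)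
    else i).val = _
  split_ifs <;> rfl

/-- Reversing the block of positions from `1` to `k` only changes the two boundary products. -/
theorem SOP_reverseBlock {n : ℕ} (a : Fin n → ℝ) (π : Equiv.Perm (Fin n)) (z k : Fin n)
    (hz : z.val = 0) (hk : 0 < k.val) (hkn : k.val + 1 < n) :
    SOP a ((reverseBlock 1 k).trans π) - SOP a π =
      (a (π z) - a (π (cycSucc k))) * (a (π k) - a (π (cycSucc z))) := by
  unfold SOP
  rw [← Equiv.sum_comp (reverseBlock 0 k) (fun i => a (π i) * a (π (cycSucc i))),
    ← Finset.sum_sub_distrib]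
  have hzk : z ≠ k := by
    rintro rfl
    omega
  have hsz := val_cycSucc_of_lt (i := z) (by omega)
  have hsk := val_cycSucc_of_lt hkn
  rw [Fintype.sum_eq_add z k hzk]
  · have h₁ : reverseBlock 1 k z = z := by
      ext; rw [val_reverseBlock]; split_ifs <;> omega
    have h₂ : reverseBlock 1 k (cycSucc z) = k := by
      ext; rw [val_reverseBlock]; split_ifs <;> omega
    have h₃ : reverseBlock 1 k k = cycSucc z := by
      ext; rw [val_reverseBlock]; split_ifs <;> omega
    have h₄ : reverseBlock 1 k (cycSucc k) = cycSucc k := by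
      ext; rw [val_reverseBlock]; split_ifs <;> omega
    have h₅ : reverseBlock 0 k z = k := by
      ext; rw [val_reverseBlock]; split_ifs <;> omega
    have h₆ : reverseBlock 0 k k = z := by
      ext; rw [val_reverseBlock]; split_ifs <;> omega
    simp only [Equiv.trans_apply, h₁, h₂, h₃, h₄, h₅, h₆]
    ring
  · rintro i ⟨hiz, hik⟩
    have hiz' : i.val ≠ 0 := fun h => hiz (Fin.ext (h.trans hz.symm))
    have hik' : i.val ≠ k.val := fun h => hik (Fin.ext h)
    simp only [Equiv.trans_apply]
    by_cases h : i.val < k.val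
    · have hsi := val_cycSucc_of_lt (i := i) (by omega)
      have hτ : (reverseBlock 0 k i).val = k.val - i.val := by
        rw [val_reverseBlock]; split_ifs <;> omega
      have hsτ := val_cycSucc_of_lt (i := reverseBlock 0 k i) (by omega)
      have h₁ : reverseBlock 1 k i = cycSucc (reverseBlock 0 k i) := by
        ext; rw [val_reverseBlock]; split_ifs <;> omega
      have h₂ : reverseBlock 1 k (cycSucc i) = reverseBlock 0 k i := by
        ext; rw [val_reverseBlock]; split_ifs <;> omega
      rw [h₁, h₂]
      ring
    · have hτ : reverseBlock 0 k i = i := by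
        ext; rw [val_reverseBlock]; split_ifs <;> omega
      have h₁ : reverseBlock 1 k i = i := by
        ext; rw [val_reverseBlock]; split_ifs <;> omega
      have h₂ : reverseBlock 1 k (cycSucc i) = cycSucc i := by
        ext
        rw [val_reverseBlock]
        by_cases hi : i.val + 1 < n
        · have hsi := val_cycSucc_of_lt hi
          split_ifs <;> omega
        · have hsi : (cycSucc i).val = 0 := by
            have : i.val + 1 = n := by omega
            simp [cycSucc, this]
          split_ifs <;> omega
      rw [hτ, h₁, h₂]
      ring

/-- For `n ≥ 3` nonnegative reals there is a circular permutation minimizing the sum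
of adjacent products in which a minimum value is cyclically adjacent to a maximum
value. -/
theorem SOP_min_adjacent_max (n : ℕ) (hn : 3 ≤ n) (a : Fin n → ℝ) (ha : ∀ i, 0 ≤ a i) :
    ∃ π : Equiv.Perm (Fin n),
      (∀ π' : Equiv.Perm (Fin n), SOP a π ≤ SOP a π') ∧
      ∃ i : Fin n,
        ((∀ j, a (π i) ≤ a j) ∧ (∀ j, a j ≤ a (π (cycSucc i)))) ∨
        ((∀ j, a (π (cycSucc i)) ≤ a j) ∧ (∀ j, a j ≤ a (π i))) := by
  have : NeZero n := ⟨by omega⟩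
  obtain ⟨σ, hσ⟩ := Finite.exists_min (SOP a)
  obtain ⟨p, hp⟩ := Finite.exists_min (fun i => a (σ i))
  obtain ⟨π, hπ, hmin⟩ : ∃ π : Equiv.Perm (Fin n),
      (∀ π', SOP a π ≤ SOP a π') ∧ ∀ j, a (π 0) ≤ a j := by
    refine ⟨(Equiv.addRight p).trans σ, fun π' => (SOP_rotate a σ p).trans_le (hσ π'), fun j => ?_⟩
    simpa using hp (σ.symm j)
  obtain ⟨k, hk⟩ := Finite.exists_max (fun i => a (π i))
  have hmax : ∀ j, a j ≤ a (π k) := fun j => by simpa using hk (π.symm j)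
  rcases Nat.eq_zero_or_pos k.val with h0 | h0
  · obtain rfl : k = 0 := Fin.ext (by simpa using h0)
    exact ⟨π, hπ, 0, Or.inl ⟨hmin, fun j => (hmax j).trans (hmin _)⟩⟩
  by_cases hkn : k.val + 1 < n
  · have hdiff := SOP_reverseBlock a π 0 k (by simp) h0 hkn
    have hle : SOP a ((reverseBlock 1 k).trans π) ≤ SOP a π := sub_nonpos.1 <|
      hdiff.trans_le <| mul_nonpos_of_nonpos_of_nonneg
        (sub_nonpos.2 (hmin _)) (sub_nonneg.2 (hmax _))
    refine ⟨_, fun π' => hle.trans (hπ π'), 0, Or.inl ?_⟩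
    have hs := val_cycSucc_of_lt (i := (0 : Fin n)) (by simp; omega)
    have hz : (0 : Fin n).val = 0 := by simp
    have h₁ : reverseBlock 1 k 0 = 0 := by
      ext; rw [val_reverseBlock]; split_ifs <;> omega
    have h₂ : reverseBlock 1 k (cycSucc 0) = k := by
      ext; rw [val_reverseBlock]; split_ifs <;> omega
    simpa only [Equiv.trans_apply, h₁, h₂] using And.intro hmin hmax
  · have hs : cycSucc k = 0 := by
      have : k.val + 1 = n := by omega
      ext
      simp [cycSucc, this]
    exact ⟨π, hπ, k, Or.inr ⟨by rwa [hs], hmax⟩⟩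
end

section
/- Let n ≥ 2, let x_1 ≥ x_2 ≥ … ≥ x_n and y_1 ≤ y_2 ≤ … ≤ y_n be real numbers, and let ϱ be a permutation of {1,…,n} that consists of a single cycle of length n (an n-cycle). Then Σ_{i=1}^n x_i·y_{ϱ(i)} ≥ Σ_{i=1}^n x_i·y_i + Σ_{i=1}^{n−1} (x_i − x_{i+1})·(y_{i+1} − y_i). -/
theorem Equiv.Perm.IsCycle.exists_mem_apply_notMem {α : Type*} [Fintype α] [DecidableEq α]
    {σ : Equiv.Perm α} (hσ : σ.IsCycle) (hsupp : σ.support = Finset.univ) {S : Finset α}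
    {a b : α} (ha : a ∈ S) (hb : b ∉ S) : ∃ i ∈ S, σ i ∉ S := by
  by_contra! h
  have hne (z : α) : σ z ≠ z := Equiv.Perm.mem_support.mp (hsupp ▸ Finset.mem_univ z)
  obtain ⟨m, rfl⟩ := hσ.exists_pow_eq (hne a) (hne b)
  refine hb ?_
  clear hb
  induction m with
  | zero => simpa using ha
  | succ m ih =>
    rw [pow_succ', Equiv.Perm.mul_apply]
    exact h _ ih

/-- Transporting a set by a permutation that does not preserve it increases the sum of `f` by at
least the gap between the values of `f` inside and outside the set. -/
theorem sub_le_sum_apply_sub {α : Type*} [DecidableEq α] (σ : Equiv.Perm α) {S : Finset α}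
    {f : α → ℝ} {a b : ℝ} (hab : a ≤ b) (hin : ∀ i ∈ S, f i ≤ a) (hout : ∀ i ∉ S, b ≤ f i)
    (hS : ∃ i ∈ S, σ i ∉ S) : b - a ≤ ∑ i ∈ S, (f (σ i) - f i) := by
  set T := S.map σ.toEmbedding with hT
  have hsum : ∑ i ∈ S, (f (σ i) - f i) = ∑ i ∈ T \ S, f i - ∑ i ∈ S \ T, f i := by
    rw [Finset.sum_sdiff_sub_sum_sdiff, hT, Finset.sum_map, Finset.sum_sub_distrib]
    rfl
  have hcard : (T \ S).card = (S \ T).card :=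
    Finset.card_sdiff_comm (Finset.card_map _)
  have hpos : 1 ≤ (T \ S).card := by
    obtain ⟨i, hi, hi'⟩ := hS
    exact Finset.card_pos.mpr
      ⟨σ i, Finset.mem_sdiff.mpr ⟨Finset.mem_map_of_mem σ.toEmbedding hi, hi'⟩⟩
  have hlo : (T \ S).card • b ≤ ∑ i ∈ T \ S, f i :=
    Finset.card_nsmul_le_sum _ _ _ fun i hi => hout i (Finset.mem_sdiff.mp hi).2
  have hhi : ∑ i ∈ S \ T, f i ≤ (S \ T).card • a :=
    Finset.sum_le_card_nsmul _ _ _ fun i hi => hin i (Finset.mem_sdiff.mp hi).1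
  rw [← hcard] at hhi
  rw [nsmul_eq_mul] at hlo hhi
  have hpos' : (1 : ℝ) ≤ (T \ S).card := by exact_mod_cast hpos
  rw [hsum]
  nlinarith [mul_nonneg (sub_nonneg.mpr hpos') (sub_nonneg.mpr hab)]

theorem eq_add_sum_range_ite_sub (x : ℕ → ℝ) {i m : ℕ} (him : i ≤ m) :
    x i = x m + ∑ k ∈ Finset.range m, if i ≤ k then x k - x (k + 1) else 0 := by
  induction m, him using Nat.le_induction with
  | base =>
    rw [Finset.sum_eq_zero, add_zero]
    intro k hk
    exact if_neg (not_le.mpr (Finset.mem_range.mp hk))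
  | succ m him ih =>
    rw [Finset.sum_range_succ, if_pos him]
    linarith

/-- Abel summation against weights of total sum zero. -/
theorem sum_mul_eq_sum_range_sub_mul {n : ℕ} (x : ℕ → ℝ) (d : Fin n → ℝ) (hd : ∑ i, d i = 0) :
    ∑ i : Fin n, x i * d i = ∑ k ∈ Finset.range (n - 1),
      (x k - x (k + 1)) * ∑ i : Fin n with i.val ≤ k, d i := by
  calc ∑ i : Fin n, x i * d i
      = ∑ i : Fin n, (x (n - 1) * d i + ∑ k ∈ Finset.range (n - 1),
          if i.val ≤ k then (x k - x (k + 1)) * d i else 0) := by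
        refine Finset.sum_congr rfl fun i _ => ?_
        rw [eq_add_sum_range_ite_sub x (Nat.le_sub_one_of_lt i.isLt), add_mul, Finset.sum_mul]
        simp only [ite_mul, zero_mul]
    _ = _ := by
        rw [Finset.sum_add_distrib, ← Finset.mul_sum, hd, mul_zero, zero_add, Finset.sum_comm]
        refine Finset.sum_congr rfl fun k _ => ?_
        rw [Finset.mul_sum, Finset.sum_filter]


/-- Lemma 1, Inequality (1): if `x 0 ≥ x 1 ≥ … ≥ x (n-1)` and `y 0 ≤ y 1 ≤ … ≤ y (n-1)`
(0-indexed, so `x i` is the `(i+1)`-th maximum and `y i` the `(i+1)`-th minimum) and `ϱ`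
is a permutation of `Fin n` consisting of a single `n`-cycle, then
`∑ x_i y_{ϱ(i)} ≥ ∑ x_i y_i + ∑_{i=1}^{n-1} (x_i − x_{i+1})(y_{i+1} − y_i)`. -/
theorem single_cycle_lower_bound (n : ℕ) (hn : 2 ≤ n) (x y : ℕ → ℝ)
    (hx : ∀ i : ℕ, i + 1 < n → x (i + 1) ≤ x i)
    (hy : ∀ i : ℕ, i + 1 < n → y i ≤ y (i + 1))
    (ϱ : Equiv.Perm (Fin n)) (hϱ : ϱ.IsCycle ∧ ϱ.support = Finset.univ) :
    ∑ i : Fin n, x i * y (ϱ i) ≥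
      ∑ i : Fin n, x i * y i
        + ∑ i ∈ Finset.range (n - 1), (x i - x (i + 1)) * (y (i + 1) - y i) := by
  have hmono : ∀ i j : ℕ, i ≤ j → j < n → y i ≤ y j := by
    intro i j hij
    induction j, hij using Nat.le_induction with
    | base => exact fun _ => le_rfl
    | succ j _ ih => exact fun hj => (ih (by omega)).trans (hy j hj)
  have hd : ∑ i : Fin n, (y (ϱ i) - y i) = 0 := by
    rw [Finset.sum_sub_distrib, Equiv.sum_comp ϱ fun i => y i, sub_self]
  have habel := sum_mul_eq_sum_range_sub_mul x (fun i => y (ϱ i) - y i) hd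
  simp only [mul_sub (x _), Finset.sum_sub_distrib (s := Finset.univ)] at habel
  rw [ge_iff_le, ← le_sub_iff_add_le', habel]
  refine Finset.sum_le_sum fun k hk => ?_
  have hk' : k + 1 < n := by have := Finset.mem_range.mp hk; omega
  refine mul_le_mul_of_nonneg_left ?_ (sub_nonneg.mpr (hx k hk'))
  refine sub_le_sum_apply_sub ϱ (f := fun i => y i) (hy k hk') ?_ ?_ ?_
  · intro i hi
    exact hmono i k (Finset.mem_filter.mp hi).2 (by omega)
  · intro i hi
    refine hmono (k + 1) i ?_ i.isLt
    simpa using hi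
  · exact hϱ.1.exists_mem_apply_notMem hϱ.2 (a := ⟨k, by omega⟩) (b := ⟨k + 1, hk'⟩)
      (by simp) (by simp)
end

section
/- Let n ≥ 3 and let w_0(i), w_1(i) ≥ 0 for i = 1,…,n. For bits t_1, t_i ∈ {0,1} and 2 ≤ i ≤ n define f_i(t_1, t_i) = max over t_2,…,t_{i−1} ∈ {0,1} of min_{1≤j≤i−1} ( w_{1−t_j}(j) + w_{t_{j+1}}(j+1) ). Then: (a) for every 3 ≤ i ≤ n and all t_1, t_i ∈ {0,1}, f_i(t_1, t_i) = max_{t_{i−1} ∈ {0,1}} min( f_{i−1}(t_1, t_{i−1}), w_{1−t_{i−1}}(i−1) + w_{t_i}(i) ); and (b) max over t = (t_1,…,t_n) ∈ {0,1}^n of min_{1≤i≤n} θ_i equals max over t_1, t_n ∈ {0,1} of min( f_n(t_1, t_n), w_{t_1}(1) + w_{1−t_n}(n) ), where θ_i = w_{1−t_i}(i) + w_{t_{i⊕1}}(i⊕1) and i⊕1 denotes i+1 mod n. -/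
/-- `reF w i t1 ti` is the maximum, over all sub-wedge assignments `t : {0,1}`-valued with
`t 1 = t1` and `t i = ti`, of the minimum over `1 ≤ j ≤ i-1` of
`w_{1−t_j}(j) + w_{t_{j+1}}(j+1)`.  Here `w j b` denotes the sub-wedge `w_b(j)`
(with `b : Bool`, `!b` playing the role of `1 − b`). -/
noncomputable def reF (w : ℕ → Bool → ℝ) (i : ℕ) (t1 ti : Bool) : ℝ :=
  sSup {v : ℝ | ∃ t : ℕ → Bool, t 1 = t1 ∧ t i = ti ∧
    v = sInf {u : ℝ | ∃ j : ℕ, 1 ≤ j ∧ j ≤ i - 1 ∧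
          u = w j (!t j) + w (j + 1) (t (j + 1))}}

/-- A threshold `c` is at most a finite max-min value iff a single choice attains it at every index. -/
theorem le_sSup_sInf_iff {T : Type*} {P : T → Prop} {F : T → ℕ → ℝ} {n : ℕ} (hn : 1 ≤ n)
    (hP : ∃ t, P t) (hF : ∀ j, (Set.range fun t => F t j).Finite) (c : ℝ) :
    c ≤ sSup {v : ℝ | ∃ t, P t ∧ v = sInf {u : ℝ | ∃ j : ℕ, 1 ≤ j ∧ j ≤ n ∧ u = F t j}} ↔
      ∃ t, P t ∧ ∀ j, 1 ≤ j → j ≤ n → c ≤ F t j := by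
  have hfin : (⋃ j ∈ Set.Icc 1 n, Set.range fun t => F t j).Finite :=
    (Set.finite_Icc 1 n).biUnion fun j _ => hF j
  have hsub : ∀ t, {u : ℝ | ∃ j : ℕ, 1 ≤ j ∧ j ≤ n ∧ u = F t j} ⊆
      ⋃ j ∈ Set.Icc 1 n, Set.range fun t => F t j := by
    rintro t u ⟨j, h1, h2, rfl⟩
    exact Set.mem_biUnion (Set.mem_Icc.2 ⟨h1, h2⟩) ⟨t, rfl⟩
  have hne : ∀ t, {u : ℝ | ∃ j : ℕ, 1 ≤ j ∧ j ≤ n ∧ u = F t j}.Nonempty :=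
    fun t => ⟨_, 1, le_rfl, hn, rfl⟩
  have hinf : ∀ t, c ≤ sInf {u : ℝ | ∃ j : ℕ, 1 ≤ j ∧ j ≤ n ∧ u = F t j} ↔
      ∀ j, 1 ≤ j → j ≤ n → c ≤ F t j := by
    intro t
    rw [le_csInf_iff (hfin.subset (hsub t)).bddBelow (hne t)]
    constructor
    · intro h j h1 h2
      exact h _ ⟨j, h1, h2, rfl⟩
    · rintro h _ ⟨j, h1, h2, rfl⟩
      exact h j h1 h2
  set S := {v : ℝ | ∃ t, P t ∧ v = sInf {u : ℝ | ∃ j : ℕ, 1 ≤ j ∧ j ≤ n ∧ u = F t j}}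
  have hS : S.Finite := by
    refine hfin.subset ?_
    rintro v ⟨t, -, rfl⟩
    exact hsub t ((hne t).csInf_mem (hfin.subset (hsub t)))
  have hSne : S.Nonempty := hP.imp' _ fun t ht => ⟨t, ht, rfl⟩
  constructor
  · intro h
    obtain ⟨t, ht, hv⟩ := hSne.csSup_mem hS
    exact ⟨t, ht, (hinf t).1 (hv ▸ h)⟩
  · rintro ⟨t, ht, h⟩
    exact ((hinf t).2 h).trans (le_csSup hS.bddAbove ⟨t, ht, rfl⟩)

theorem finite_range_add_apply_bool (f g : Bool → ℝ) (a b : ℕ) :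
    (Set.range fun t : ℕ → Bool => f (t a) + g (t b)).Finite :=
  (Set.finite_range fun p : Bool × Bool => f p.1 + g p.2).subset <| by
    rintro _ ⟨t, rfl⟩
    exact ⟨(t a, t b), rfl⟩

theorem le_reF_iff (w : ℕ → Bool → ℝ) {k : ℕ} (hk : 1 ≤ k) (t1 ti : Bool) (c : ℝ) :
    c ≤ reF w (k + 1) t1 ti ↔ ∃ t : ℕ → Bool, t 1 = t1 ∧ t (k + 1) = ti ∧
      ∀ j, 1 ≤ j → j ≤ k → c ≤ w j (!t j) + w (j + 1) (t (j + 1)) := by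
  have h := le_sSup_sInf_iff (P := fun t : ℕ → Bool => t 1 = t1 ∧ t (k + 1) = ti)
    (F := fun t j => w j (!t j) + w (j + 1) (t (j + 1))) hk
    ⟨fun j => if j = 1 then t1 else ti, by simp, by simp; omega⟩
    (fun j => finite_range_add_apply_bool (fun b => w j (!b)) (w (j + 1)) j (j + 1)) c
  simpa only [reF, and_assoc, Nat.add_sub_cancel] using h

theorem reF_succ (w : ℕ → Bool → ℝ) {k : ℕ} (hk : 1 ≤ k) (t1 ti : Bool) :
    reF w (k + 2) t1 ti
      = max (min (reF w (k + 1) t1 false) (w (k + 1) true + w (k + 2) ti))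
            (min (reF w (k + 1) t1 true) (w (k + 1) false + w (k + 2) ti)) := by
  refine eq_of_forall_le_iff fun c => ?_
  have hext : ∀ b : Bool, c ≤ reF w (k + 1) t1 b → c ≤ w (k + 1) (!b) + w (k + 2) ti →
      c ≤ reF w (k + 2) t1 ti := by
    intro b hb hc
    obtain ⟨t, h1, h2, h⟩ := (le_reF_iff w hk _ _ _).1 hb
    refine (le_reF_iff w (by omega) _ _ _).2 ⟨Function.update t (k + 2) ti, ?_, by simp, ?_⟩
    · rwa [Function.update_of_ne (by omega)]
    · intro j hj1 hj2
      rw [Function.update_of_ne (by omega : j ≠ k + 2)]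
      rcases hj2.lt_or_eq with hj | rfl
      · rw [Function.update_of_ne (by omega : j + 1 ≠ k + 2)]
        exact h j hj1 (by omega)
      · simpa [h2] using hc
  rw [le_max_iff, le_min_iff, le_min_iff]
  constructor
  · intro h
    obtain ⟨t, h1, h2, h⟩ := (le_reF_iff w (by omega) _ _ _).1 h
    have hpre : c ≤ reF w (k + 1) t1 (t (k + 1)) :=
      (le_reF_iff w hk _ _ _).2 ⟨t, h1, rfl, fun j hj1 hj2 => h j hj1 (by omega)⟩
    have hlast := h (k + 1) (by omega) le_rfl
    rw [h2] at hlast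
    cases hb : t (k + 1) <;> rw [hb] at hpre hlast
    · exact Or.inl ⟨hpre, hlast⟩
    · exact Or.inr ⟨hpre, hlast⟩
  · rintro (⟨h, h'⟩ | ⟨h, h'⟩)
    · exact hext false h h'
    · exact hext true h h'

theorem le_sSup_sInf_cyclic_iff (w : ℕ → Bool → ℝ) {k : ℕ} (hk : 1 ≤ k) (c : ℝ) :
    c ≤ sSup {v : ℝ | ∃ t : ℕ → Bool,
        v = sInf {u : ℝ | ∃ i : ℕ, 1 ≤ i ∧ i ≤ k + 1 ∧
              u = w i (!t i) + w (if i = k + 1 then 1 else i + 1)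
                (t (if i = k + 1 then 1 else i + 1))}} ↔
      ∃ a b : Bool, c ≤ reF w (k + 1) a b ∧ c ≤ w 1 a + w (k + 1) (!b) := by
  have h := le_sSup_sInf_iff (P := fun _ : ℕ → Bool => True)
    (F := fun t i => w i (!t i) + w (if i = k + 1 then 1 else i + 1)
      (t (if i = k + 1 then 1 else i + 1))) (n := k + 1) (by omega) ⟨fun _ => true, trivial⟩
    (fun j => finite_range_add_apply_bool (fun b => w j (!b)) (w _) j _) c
  simp only [true_and] at h
  rw [h]
  constructor
  · rintro ⟨t, ht⟩
    refine ⟨t 1, t (k + 1), (le_reF_iff w hk _ _ _).2 ⟨t, rfl, rfl, fun j hj1 hj2 => ?_⟩, ?_⟩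
    · have := ht j hj1 (by omega)
      rwa [if_neg (by omega)] at this
    · have := ht (k + 1) (by omega) le_rfl
      rwa [if_pos rfl, add_comm] at this
  · rintro ⟨a, b, hf, hc⟩
    obtain ⟨t, rfl, rfl, ht⟩ := (le_reF_iff w hk _ _ _).1 hf
    refine ⟨t, fun j hj1 hj2 => ?_⟩
    rcases hj2.lt_or_eq with hj | rfl
    · rw [if_neg (by omega)]
      exact ht j hj1 (by omega)
    · rwa [if_pos rfl, add_comm]

/-- Theorem 2 (RE2): the dynamic-programming recurrence for `reF`, and the fact that the
optimal angular resolution `max_t min_i θ_i` (with `θ_i = w_{1−t_i}(i) + w_{t_{i⊕1}}(i⊕1)`,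
`i ⊕ 1` taken cyclically in `{1,…,n}`) equals
`max_{t1,tn} min (reF n t1 tn) (w_{t1}(1) + w_{1−tn}(n))`. -/
theorem RE2_dynamic_programming (n : ℕ) (hn : 3 ≤ n) (w : ℕ → Bool → ℝ)
    (hw : ∀ i : ℕ, 1 ≤ i → i ≤ n → ∀ b, 0 ≤ w i b) :
    (∀ i : ℕ, 3 ≤ i → i ≤ n → ∀ t1 ti : Bool,
      reF w i t1 ti
        = max (min (reF w (i - 1) t1 false) (w (i - 1) true + w i ti))
              (min (reF w (i - 1) t1 true) (w (i - 1) false + w i ti)))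
    ∧
    sSup {v : ℝ | ∃ t : ℕ → Bool,
        v = sInf {u : ℝ | ∃ i : ℕ, 1 ≤ i ∧ i ≤ n ∧
              u = w i (!t i) + w (if i = n then 1 else i + 1) (t (if i = n then 1 else i + 1))}}
      = max (max (min (reF w n false false) (w 1 false + w n true))
                 (min (reF w n false true) (w 1 false + w n false)))
            (max (min (reF w n true false) (w 1 true + w n true))
                 (min (reF w n true true) (w 1 true + w n false))) := by
  constructor
  · intro i hi _ t1 ti
    obtain ⟨k, rfl⟩ := Nat.exists_eq_add_of_le' (show 2 ≤ i by omega)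
    exact reF_succ w (by omega) t1 ti
  · obtain ⟨k, rfl⟩ := Nat.exists_eq_add_of_le' (show 1 ≤ n by omega)
    refine eq_of_forall_le_iff fun c => ?_
    rw [le_sSup_sInf_cyclic_iff w (by omega) c]
    simp only [Bool.exists_bool, le_max_iff, le_min_iff, Bool.not_false, Bool.not_true]
end

section
/- Let n ≥ 1 and let w_0(i), w_1(i) ≥ 0 for i = 1,…,n satisfy Σ_{i=1}^n (w_0(i) + w_1(i)) = 2π. Then for every circular permutation σ of {1,…,n} and every assignment t ∈ {0,1}^n, StdDev_{σ,t}² = (1/n)·Σ_{i=1}^n (w_0(i)² + w_1(i)²) + (2/n)·SOP_{σ,t} − (2π/n)². Consequently, minimizing StdDev_{σ,t} over all (σ,t) is equivalent to minimizing SOP_{σ,t} over all (σ,t). -/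
/-- The `i`-th angle `θ_i = w_{t'_i}(σ_i) + w_{t_{i⊕1}}(σ_{i⊕1})` of the balloon drawing
given by circular permutation `σ` and sub-wedge assignment `t` (a `Bool`, with `!t i`
playing the role of `t'_i = 1 − t_i`). -/
noncomputable def theta {n : ℕ} (w : Fin n → Bool → ℝ) (σ : Equiv.Perm (Fin n))
    (t : Fin n → Bool) (i : Fin n) : ℝ :=
  w (σ i) (!t i) + w (σ (cycSucc i)) (t (cycSucc i))

/-- The sum of products of adjacent sub-wedges
`SOP_{σ,t} = ∑ i, w_{t'_i}(σ_i) · w_{t_{i⊕1}}(σ_{i⊕1})`. -/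
noncomputable def SOPwt {n : ℕ} (w : Fin n → Bool → ℝ) (σ : Equiv.Perm (Fin n))
    (t : Fin n → Bool) : ℝ :=
  ∑ i : Fin n, w (σ i) (!t i) * w (σ (cycSucc i)) (t (cycSucc i))

/-- The standard deviation of the angles of the drawing `(σ, t)`. -/
noncomputable def stdDev {n : ℕ} (w : Fin n → Bool → ℝ) (σ : Equiv.Perm (Fin n))
    (t : Fin n → Bool) : ℝ :=
  Real.sqrt ((1 / n) * ∑ i : Fin n, (theta w σ t i) ^ 2
    - ((1 / n) * ∑ i : Fin n, theta w σ t i) ^ 2)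

theorem cycSucc_bijective (n : ℕ) : Function.Bijective (cycSucc : Fin n → Fin n) := by
  refine Finite.injective_iff_bijective.mp fun a b h => ?_
  have h' : a.val + 1 ≡ b.val + 1 [MOD n] := congrArg Fin.val h
  exact Fin.ext ((Nat.ModEq.add_right_cancel' 1 h').eq_of_lt_of_lt a.isLt b.isLt)

/-- Each sub-wedge contributes to exactly one angle. -/
theorem sum_adjacent_subwedges {n : ℕ} (w : Fin n → Bool → ℝ) (σ : Equiv.Perm (Fin n))
    (t : Fin n → Bool) (f : ℝ → ℝ) :
    ∑ i, (f (w (σ i) (!t i)) + f (w (σ (cycSucc i)) (t (cycSucc i))))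
      = ∑ i, (f (w i false) + f (w i true)) := by
  rw [Finset.sum_add_distrib,
    (cycSucc_bijective n).sum_comp fun i => f (w (σ i) (t i)), ← Finset.sum_add_distrib,
    ← Equiv.sum_comp σ fun i => f (w i false) + f (w i true)]
  refine Finset.sum_congr rfl fun i _ => ?_
  cases t i <;> simp [add_comm]

theorem sum_theta {n : ℕ} (w : Fin n → Bool → ℝ) (σ : Equiv.Perm (Fin n))
    (t : Fin n → Bool) : ∑ i, theta w σ t i = ∑ i, (w i false + w i true) :=
  sum_adjacent_subwedges w σ t id

theorem sum_theta_sq {n : ℕ} (w : Fin n → Bool → ℝ) (σ : Equiv.Perm (Fin n))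
    (t : Fin n → Bool) :
    ∑ i, theta w σ t i ^ 2
      = ∑ i, (w i false ^ 2 + w i true ^ 2) + 2 * SOPwt w σ t := by
  rw [← sum_adjacent_subwedges w σ t (· ^ 2), SOPwt, Finset.mul_sum,
    ← Finset.sum_add_distrib]
  refine Finset.sum_congr rfl fun i _ => ?_
  rw [theta]
  ring

theorem stdDev_nonneg {n : ℕ} (w : Fin n → Bool → ℝ) (σ : Equiv.Perm (Fin n))
    (t : Fin n → Bool) : 0 ≤ stdDev w σ t :=
  Real.sqrt_nonneg _

/-- The radicand in the standard deviation is nonnegative, so squaring cancels the root. -/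
theorem stdDev_sq {n : ℕ} (w : Fin n → Bool → ℝ) (σ : Equiv.Perm (Fin n))
    (t : Fin n → Bool) :
    stdDev w σ t ^ 2 = (1 / n) * ∑ i : Fin n, theta w σ t i ^ 2
      - ((1 / n) * ∑ i : Fin n, theta w σ t i) ^ 2 := by
  refine Real.sq_sqrt (sub_nonneg.mpr ?_)
  rcases Nat.eq_zero_or_pos n with rfl | hn
  · simp
  have hn' : (0 : ℝ) < n := Nat.cast_pos.mpr hn
  have h : (∑ i, theta w σ t i) ^ 2 ≤ n * ∑ i, theta w σ t i ^ 2 := by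
    simpa using sq_sum_le_card_mul_sum_sq (s := Finset.univ) (f := theta w σ t)
  calc ((1 / n) * ∑ i, theta w σ t i) ^ 2
      = (1 / n) ^ 2 * (∑ i, theta w σ t i) ^ 2 := mul_pow _ _ _
    _ ≤ (1 / n) ^ 2 * (n * ∑ i, theta w σ t i ^ 2) := by gcongr
    _ = (1 / n) * ∑ i, theta w σ t i ^ 2 := by field_simp

/-- Equation (2): if the sub-wedges sum to `2π` then
`StdDev² = (1/n)·∑ (w₀(i)² + w₁(i)²) + (2/n)·SOP − (2π/n)²`; consequently minimizing
the standard deviation of angles is equivalent to minimizing the sum of products of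
adjacent sub-wedges. -/
theorem stdDev_eq_SOP (n : ℕ) (hn : 1 ≤ n) (w : Fin n → Bool → ℝ)
    (hw : ∀ i b, 0 ≤ w i b)
    (hsum : ∑ i : Fin n, (w i false + w i true) = 2 * Real.pi) :
    (∀ (σ : Equiv.Perm (Fin n)) (t : Fin n → Bool),
      (stdDev w σ t) ^ 2
        = (1 / n) * (∑ i : Fin n, ((w i false) ^ 2 + (w i true) ^ 2))
          + (2 / n) * SOPwt w σ t - (2 * Real.pi / n) ^ 2)
    ∧
    (∀ (σ : Equiv.Perm (Fin n)) (t : Fin n → Bool) (σ' : Equiv.Perm (Fin n))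
        (t' : Fin n → Bool),
      stdDev w σ t ≤ stdDev w σ' t' ↔ SOPwt w σ t ≤ SOPwt w σ' t') := by
  have key : ∀ (σ : Equiv.Perm (Fin n)) (t : Fin n → Bool),
      (stdDev w σ t) ^ 2
        = (1 / n) * (∑ i : Fin n, ((w i false) ^ 2 + (w i true) ^ 2))
          + (2 / n) * SOPwt w σ t - (2 * Real.pi / n) ^ 2 := by
    intro σ t
    rw [stdDev_sq, sum_theta, sum_theta_sq, hsum]
    ring
  refine ⟨key, fun σ t σ' t' => ?_⟩
  have hn' : (0 : ℝ) < 2 / n := div_pos two_pos (Nat.cast_pos.mpr hn)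
  rw [← sq_le_sq₀ (stdDev_nonneg w σ t)
    (stdDev_nonneg w σ' t'), key, key, sub_le_sub_iff_right,
    add_le_add_iff_left, mul_le_mul_iff_right₀ hn']
end

section
/- Let n ≥ 2 and let w_0(i), w_1(i) > 0 for i = 1,…,n. If a circular permutation σ of {1,…,n} and an assignment t ∈ {0,1}^n satisfy AngResl_{σ,t} = max over all (σ',t') of AngResl_{σ',t'}, then AspRatio_{σ,t} ≤ 2 · ( min over all (σ',t') of AspRatio_{σ',t'} ). In other words, any drawing attaining the optimal angular resolution is a 2-approximation for the optimal aspect ratio of unordered trees with flexible uneven sub-wedges (the RA4 problem). -/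
/-- The angular resolution `AngResl_{σ,t} = min_i θ_i`. -/
noncomputable def angResl {n : ℕ} (w : Fin n → Bool → ℝ) (σ : Equiv.Perm (Fin n))
    (t : Fin n → Bool) : ℝ :=
  sInf (Set.range (theta w σ t))

/-- The aspect ratio `AspRatio_{σ,t} = (max_i θ_i) / (min_i θ_i)`. -/
noncomputable def aspRatio {n : ℕ} (w : Fin n → Bool → ℝ) (σ : Equiv.Perm (Fin n))
    (t : Fin n → Bool) : ℝ :=
  sSup (Set.range (theta w σ t)) / sInf (Set.range (theta w σ t))

theorem cycSucc_surjective {n : ℕ} : Function.Surjective (cycSucc (n := n)) := by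
  intro i
  have hi := i.isLt
  rcases Nat.eq_zero_or_pos i.val with h | h
  · refine ⟨⟨n - 1, by omega⟩, Fin.ext ?_⟩
    have h1 : n - 1 + 1 = n := by omega
    simp [cycSucc, h1, h]
  · refine ⟨⟨i.val - 1, by omega⟩, Fin.ext ?_⟩
    have h1 : i.val - 1 + 1 = i.val := by omega
    simp [cycSucc, h1, Nat.mod_eq_of_lt hi]

/-- Every sub-wedge lies in some angle of every drawing. -/
theorem exists_le_theta {n : ℕ} {w : Fin n → Bool → ℝ} (hw : ∀ i b, 0 < w i b)
    (σ : Equiv.Perm (Fin n)) (t : Fin n → Bool) (j : Fin n) (b : Bool) :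
    ∃ i, w j b ≤ theta w σ t i := by
  obtain ⟨k, rfl⟩ := σ.surjective j
  by_cases hb : t k = b
  · obtain ⟨i, rfl⟩ := cycSucc_surjective k
    exact ⟨i, by rw [theta, hb]; linarith [hw (σ i) (!t i)]⟩
  · have hb' : (!t k) = b := by rwa [Bool.not_eq]
    exact ⟨k, by rw [theta, hb']; linarith [hw (σ (cycSucc k)) (t (cycSucc k))]⟩

theorem le_sSup_theta {n : ℕ} {w : Fin n → Bool → ℝ} (hw : ∀ i b, 0 < w i b)
    (σ : Equiv.Perm (Fin n)) (t : Fin n → Bool) (j : Fin n) (b : Bool) :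
    w j b ≤ sSup (Set.range (theta w σ t)) := by
  obtain ⟨i, hi⟩ := exists_le_theta hw σ t j b
  exact hi.trans (le_csSup (Set.finite_range _).bddAbove ⟨i, rfl⟩)

/-- The largest angle of a drawing is at most twice the largest angle of any other. -/
theorem sSup_theta_le_two_mul {n : ℕ} [NeZero n] {w : Fin n → Bool → ℝ}
    (hw : ∀ i b, 0 < w i b) (σ σ' : Equiv.Perm (Fin n)) (t t' : Fin n → Bool) :
    sSup (Set.range (theta w σ t)) ≤ 2 * sSup (Set.range (theta w σ' t')) := by
  refine csSup_le (Set.range_nonempty _) ?_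
  rintro _ ⟨i, rfl⟩
  rw [theta, two_mul]
  exact add_le_add (le_sSup_theta hw ..) (le_sSup_theta hw ..)

theorem angResl_pos {n : ℕ} [NeZero n] {w : Fin n → Bool → ℝ} (hw : ∀ i b, 0 < w i b)
    (σ : Equiv.Perm (Fin n)) (t : Fin n → Bool) : 0 < angResl w σ t := by
  obtain ⟨i, hi⟩ := (Set.range_nonempty (theta w σ t)).csInf_mem (Set.finite_range _)
  rw [angResl, ← hi]
  exact add_pos (hw _ _) (hw _ _)

/-- Theorem 9 for RA4: any drawing `(σ, t)` attaining the optimal angular resolution is a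
2-approximation for the optimal aspect ratio (unordered trees with flexible uneven
sub-wedges). -/
theorem RA4_two_approximation (n : ℕ) (hn : 2 ≤ n) (w : Fin n → Bool → ℝ)
    (hw : ∀ i b, 0 < w i b) (σ : Equiv.Perm (Fin n)) (t : Fin n → Bool)
    (hopt : ∀ (σ' : Equiv.Perm (Fin n)) (t' : Fin n → Bool),
      angResl w σ' t' ≤ angResl w σ t) :
    aspRatio w σ t
      ≤ 2 * sInf {r : ℝ | ∃ (σ' : Equiv.Perm (Fin n)) (t' : Fin n → Bool),
          r = aspRatio w σ' t'} := by
  have : NeZero n := ⟨by omega⟩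
  suffices h : aspRatio w σ t / 2 ≤ sInf {r : ℝ | ∃ (σ' : Equiv.Perm (Fin n))
      (t' : Fin n → Bool), r = aspRatio w σ' t'} by linarith
  refine le_csInf ⟨_, σ, t, rfl⟩ ?_
  rintro _ ⟨σ', t', rfl⟩
  have hsup := sSup_theta_le_two_mul hw σ σ' t t'
  have hpos : 0 ≤ sSup (Set.range (theta w σ' t')) :=
    (hw 0 true).le.trans (le_sSup_theta hw σ' t' 0 true)
  calc aspRatio w σ t / 2 = sSup (Set.range (theta w σ t)) / 2 / angResl w σ t :=
        div_right_comm _ _ _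
    _ ≤ sSup (Set.range (theta w σ' t')) / angResl w σ' t' :=
        div_le_div₀ hpos (by linarith) (angResl_pos hw σ' t') (hopt σ' t')
end

section
/- Let n ≥ 1 and let w_0(i), w_1(i) ≥ 0 for i = 1,…,n satisfy w_1(i) ≥ w_0(j) for all i, j ∈ {1,…,n}. Let A ≤ B be reals. If there exist a circular permutation σ of {1,…,n} and an assignment t ∈ {0,1}^n such that A ≤ θ_i ≤ B for every i, then there exists a circular permutation σ' of {1,…,n} such that, with the all-zeros assignment t' = (0,…,0), A ≤ θ'_i ≤ B for every i; in particular every angle of the drawing (σ', t') is the sum of one w_1-value and one w_0-value. -/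
/-- The angle between consecutive oriented children `x` and `y` lies in `[A, B]`; an oriented
child is entered through the sub-wedge given by its bit and left through the other one. -/
def OrientedAngleMem {α : Type*} (w : α → Bool → ℝ) (A B : ℝ) (x y : α × Bool) : Prop :=
  A ≤ w x.1 (!x.2) + w y.1 y.2 ∧ w x.1 (!x.2) + w y.1 y.2 ≤ B

/-- The angle between consecutive children `x` and `y`, both with bit `0`, lies in `[A, B]`. -/
def MixedAngleMem {α : Type*} (w : α → Bool → ℝ) (A B : ℝ) (x y : α) : Prop :=
  A ≤ w x true + w y false ∧ w x true + w y false ≤ B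

/-- Reversing every maximal run of children with bit `1` yields a chain with all bits `0`.
The second conjunct treats a run that is being reversed: `h :: r` is the reversal of the part of
the run read so far, and `e` is the first child of the run. -/
theorem exists_isChain_mixedAngleMem_aux {α : Type*} (w : α → Bool → ℝ)
    (hdom : ∀ i j, w j false ≤ w i true) (A B : ℝ) (z : α) (l : List (α × Bool)) :
    (∀ x, List.IsChain (OrientedAngleMem w A B) ((x, false) :: (l ++ [(z, false)])) →
      ∃ l' : List α, l'.Perm (l.map Prod.fst) ∧
        List.IsChain (MixedAngleMem w A B) (x :: (l' ++ [z]))) ∧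
    (∀ x h r e, (h :: r).getLast? = some e → List.IsChain (MixedAngleMem w A B) (h :: r) →
      w x true + w e true ≤ B →
      List.IsChain (OrientedAngleMem w A B) ((h, true) :: (l ++ [(z, false)])) →
      ∃ l' : List α, l'.Perm (h :: r ++ l.map Prod.fst) ∧
        List.IsChain (MixedAngleMem w A B) (x :: (l' ++ [z]))) := by
  have close_run : ∀ x h r e y, (h :: r).getLast? = some e →
      List.IsChain (MixedAngleMem w A B) (h :: r) → w x true + w e true ≤ B →
      OrientedAngleMem w A B (h, true) (y, false) → ∀ s : List α,
      List.IsChain (MixedAngleMem w A B) (y :: s) →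
      List.IsChain (MixedAngleMem w A B) (x :: (h :: r ++ y :: s)) := by
    intro x h r e y he hr hB hy s hs
    simp only [OrientedAngleMem, Bool.not_true] at hy
    rw [List.cons_append, List.isChain_cons_cons, ← List.cons_append, List.isChain_append]
    refine ⟨⟨?_, ?_⟩, hr, hs, ?_⟩
    · linarith [hdom x y]
    · linarith [hdom e h]
    · intro a ha b hb
      rw [he] at ha
      simp only [Option.mem_def, Option.some.injEq, List.head?_cons] at ha hb
      subst ha hb
      exact ⟨by linarith [hdom e h], by linarith [hdom x y]⟩
  induction l with
  | nil =>
    refine ⟨fun x hx => ⟨[], by simp, ?_⟩, fun x h r e he hr hB hc => ⟨h :: r, by simp, ?_⟩⟩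
    · simpa [OrientedAngleMem, MixedAngleMem] using hx
    · exact close_run x h r e z he hr hB (by simpa using hc) [] (by simp)
  | cons p l ih =>
    obtain ⟨y, b⟩ := p
    refine ⟨fun x hx => ?_, fun x h r e he hr hB hc => ?_⟩
    · rw [List.cons_append, List.isChain_cons_cons] at hx
      obtain ⟨hxy, hy⟩ := hx
      cases b with
      | false =>
        obtain ⟨l', hp, hl'⟩ := ih.1 y hy
        refine ⟨y :: l', by simpa using hp, ?_⟩
        rw [List.cons_append, List.isChain_cons_cons]
        exact ⟨hxy, hl'⟩
      | true =>
        obtain ⟨l', hp, hl'⟩ := ih.2 x y [] y rfl (by simp) hxy.2 hy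
        exact ⟨l', by simpa using hp, hl'⟩
    · rw [List.cons_append, List.isChain_cons_cons] at hc
      obtain ⟨hhy, hy⟩ := hc
      cases b with
      | false =>
        obtain ⟨l', hp, hl'⟩ := ih.1 y hy
        refine ⟨h :: r ++ y :: l', ?_, ?_⟩
        · exact (hp.cons y).append_left (h :: r)
        · simpa using close_run x h r e y he hr hB hhy _ hl'
      | true =>
        obtain ⟨l', hp, hl'⟩ := ih.2 x y (h :: r) e (by simpa using he)
          (List.isChain_cons_cons.2
            ⟨by simpa [OrientedAngleMem, MixedAngleMem, add_comm] using hhy, hr⟩) hB hy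
        refine ⟨l', hp.trans ?_, hl'⟩
        simpa using (List.perm_middle (a := y) (l₁ := h :: r) (l₂ := l.map Prod.fst)).symm

/-- A closed chain of oriented children through `z` with bit `0` can be rearranged into a closed
chain with all bits `0`. -/
theorem exists_isChain_mixedAngleMem {α : Type*} (w : α → Bool → ℝ)
    (hdom : ∀ i j, w j false ≤ w i true) (A B : ℝ) (z : α) (l : List (α × Bool))
    (hl : List.IsChain (OrientedAngleMem w A B) ((z, false) :: (l ++ [(z, false)]))) :
    ∃ l' : List α, l'.Perm (l.map Prod.fst) ∧
      List.IsChain (MixedAngleMem w A B) (z :: (l' ++ [z])) :=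
  (exists_isChain_mixedAngleMem_aux w hdom A B z l).1 z hl

theorem cycSucc_rev_cycSucc {n : ℕ} (i : Fin n) :
    cycSucc (Fin.rev (cycSucc i)) = Fin.rev i := by
  obtain ⟨i, hi⟩ := i
  ext
  simp only [cycSucc, Fin.val_rev]
  rcases Nat.lt_or_ge (i + 1) n with h | h
  · rw [Nat.mod_eq_of_lt h, Nat.mod_eq_of_lt (by omega)]
    omega
  · obtain rfl : n = i + 1 := by omega
    simp

/-- A drawing with all bits `1`, read backwards, has all bits `0` and the same angles. -/
theorem theta_rev_false {n : ℕ} (w : Fin n → Bool → ℝ) (σ : Equiv.Perm (Fin n)) (i : Fin n) :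
    theta w (Fin.revPerm.trans σ) (fun _ => false) i =
      theta w σ (fun _ => true) (Fin.rev (cycSucc i)) := by
  simp [theta, cycSucc_rev_cycSucc, add_comm]

/-- Normalization lemma used in the NP-hardness proof of RA4: if `w₁(i) ≥ w₀(j)` for all
`i, j`, and some drawing `(σ, t)` has every angle in `[A, B]`, then some ordering `σ'`
with the all-zeros assignment `t' = (0,…,0)` also has every angle in `[A, B]`; in
particular every angle of `(σ', t')` is the sum of one `w₁`-value and one `w₀`-value. -/
theorem RA4_normalization (n : ℕ) (hn : 1 ≤ n) (w : Fin n → Bool → ℝ)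
    (hw : ∀ i b, 0 ≤ w i b)
    (hdom : ∀ i j : Fin n, w j false ≤ w i true)
    (A B : ℝ) (hAB : A ≤ B)
    (h : ∃ (σ : Equiv.Perm (Fin n)) (t : Fin n → Bool), ∀ i : Fin n,
      A ≤ theta w σ t i ∧ theta w σ t i ≤ B) :
    ∃ σ' : Equiv.Perm (Fin n), ∀ i : Fin n,
      A ≤ theta w σ' (fun _ => false) i ∧ theta w σ' (fun _ => false) i ≤ B := by
  obtain ⟨σ, t, h⟩ := h
  by_cases ht : ∀ i, t i = true
  · obtain rfl : t = fun _ => true := funext ht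
    refine ⟨Fin.revPerm.trans σ, fun i => ?_⟩
    rw [theta_rev_false]
    exact h _
  · push Not at ht
    obtain ⟨k, hk⟩ := ht
    obtain ⟨m, rfl⟩ : ∃ m, n = m + 1 := ⟨n - 1, by omega⟩
    let g : ℕ → Fin (m + 1) := fun j => ⟨(k.val + j) % (m + 1), Nat.mod_lt _ (by omega)⟩
    let f : ℕ → Fin (m + 1) × Bool := fun j => (σ (g j), t (g j))
    have g_zero : g 0 = k := by
      ext; simp [g, Nat.mod_eq_of_lt k.isLt]
    have g_last : g (m + 1) = k := by
      ext; simp [g, Nat.mod_eq_of_lt k.isLt]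
    have g_succ : ∀ j, g (j + 1) = cycSucc (g j) := by
      intro j; ext; simp [g, cycSucc, Nat.add_assoc]
    have hk' : t k = false := by simpa using hk
    have f_zero : f 0 = (σ k, false) := by simp [f, g_zero, hk']
    have f_last : f (m + 1) = (σ k, false) := by simp [f, g_last, hk']
    have chain : List.IsChain (OrientedAngleMem w A B) ((List.range (m + 2)).map f) := by
      rw [List.isChain_iff_getElem]
      intro i hi
      simpa [OrientedAngleMem, f, g_succ, theta] using h (g i)
    have split : (List.range (m + 2)).map f =
        (σ k, false) :: ((List.range m).map (fun j => f (j + 1)) ++ [(σ k, false)]) := by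
      rw [List.range_succ_eq_map, List.range_succ]
      simp [f_zero, f_last, Function.comp_def]
    rw [split] at chain
    obtain ⟨l, hp, hl⟩ := exists_isChain_mixedAngleMem w hdom A B (σ k) _ chain
    have perm : (σ k :: l).Perm ((List.range (m + 1)).map fun j => σ (g j)) := by
      rw [List.range_succ_eq_map]
      simpa [g_zero, f, Function.comp_def] using hp
    have nodup : (σ k :: l).Nodup := by
      rw [perm.nodup_iff]
      refine List.Nodup.map_on ?_ List.nodup_range
      intro a ha b hb hab
      rw [List.mem_range] at ha hb
      have := congrArg Fin.val (σ.injective hab)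
      exact Nat.ModEq.eq_of_lt_of_lt (Nat.ModEq.add_left_cancel' k.val this) ha hb
    have length_eq : (σ k :: l).length = m + 1 := by simpa using perm.length_eq
    let s : Fin (m + 1) → Fin (m + 1) := fun i => (σ k :: l)[i.val]'(by rw [length_eq]; exact i.2)
    have s_inj : Function.Injective s := by
      intro a b hab
      exact Fin.ext ((nodup.getElem_inj_iff).1 hab)
    refine ⟨Equiv.ofBijective s (Finite.injective_iff_bijective.1 s_inj), fun i => ?_⟩
    rw [← List.cons_append, List.isChain_iff_getElem] at hl
    have hi := hl i.val (by rw [List.length_append, length_eq, List.length_singleton]; omega)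
    have e1 : ((σ k :: l) ++ [σ k])[i.val]'(by rw [List.length_append, length_eq]; omega) = s i :=
      List.getElem_append_left _
    have e2 : ((σ k :: l) ++ [σ k])[i.val + 1]'(by
        rw [List.length_append, length_eq, List.length_singleton]; omega) = s (cycSucc i) := by
      rcases Nat.lt_or_ge (i.val + 1) (m + 1) with hlt | hge
      · rw [List.getElem_append_left (by rw [length_eq]; exact hlt)]
        simp only [s, cycSucc, Nat.mod_eq_of_lt hlt]
      · have him : i.val + 1 = m + 1 := by omega
        rw [List.getElem_append_right (by rw [length_eq]; exact hge)]
        simp [s, cycSucc, him]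
    rw [e1, e2] at hi
    simpa [theta, MixedAngleMem] using hi
end
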